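/- Let β ∈ (−1, 1) and define, for t > 0 and x, y ∈ ℝ, p₀(t,x,y) := φ_t(x − y) + β · sgn(y) · φ_t(|x| + |y|), where φ_t(z) := (2πt)^{−1/2} e^{−z²/(2t)} and sgn(y) := 1 for y > 0, sgn(y) := −1 for y ≤ 0. Then there exists a constant C > 0 (independent of β, e.g. any C with u e^{−u²/4} ≤ C√(2π)/2 for all u ≥ 0 suffices after doubling) such that for all t > 0, all y ∈ ℝ and all x ≠ 0, the partial derivative ∂p₀/∂x exists at (t,x,y) and satisfies |∂p₀/∂x (t, x, y)| ≤ C · t⁻¹ · e^{−(x−y)²/(4t)}. -/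

import Mathlib

open MeasureTheory Set Real

/-- The one-dimensional Gaussian heat kernel `φ_t(z) = (2πt)^{-1/2} e^{-z²/(2t)}`. -/
noncomputable def gaussKernel (t z : ℝ) : ℝ :=
  (2 * Real.pi * t) ^ (-(1 : ℝ) / 2) * Real.exp (-z ^ 2 / (2 * t))

/-- `sgn y = 1` for `y > 0` and `-1` for `y ≤ 0`. -/
noncomputable def sgn' (y : ℝ) : ℝ := if 0 < y then 1 else -1

/-- The transition density of skew Brownian motion with skewness parameter `β`. -/
noncomputable def skewBMKernel (β t x y : ℝ) : ℝ :=
  gaussKernel t (x - y) + β * sgn' y * gaussKernel t (|x| + |y|)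

theorem hasDerivAt_gaussKernel (t z : ℝ) :
    HasDerivAt (gaussKernel t) (-(z / t) * gaussKernel t z) z := by
  have h : HasDerivAt (fun w : ℝ => -w ^ 2 / (2 * t)) (-(z / t)) z := by
    refine ((hasDerivAt_pow 2 z).neg.div_const (2 * t)).congr_deriv ?_
    rw [Nat.cast_ofNat, Nat.add_one_sub_one, pow_one, neg_div, mul_div_mul_left z t two_ne_zero]
  unfold gaussKernel
  exact (h.exp.const_mul _).congr_deriv (by ring)

theorem abs_mul_gaussKernel_le {t : ℝ} (ht : 0 < t) (z : ℝ) :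
    |z| * gaussKernel t z ≤ Real.exp (-z ^ 2 / (4 * t)) := by
  have hpos : 0 < 2 * Real.pi * t := by positivity
  have hsqrt : |z| ≤ √(2 * Real.pi * t) * Real.exp (z ^ 2 / (4 * t)) := by
    refine abs_le_of_sq_le_sq ?_ (by positivity)
    rw [mul_pow, Real.sq_sqrt hpos.le, ← Real.exp_nat_mul]
    have hexp : z ^ 2 / (2 * t) ≤ Real.exp ((2 : ℕ) * (z ^ 2 / (4 * t))) := by
      have heq : ((2 : ℕ) : ℝ) * (z ^ 2 / (4 * t)) = z ^ 2 / (2 * t) := by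
        push_cast
        field_simp
        ring
      rw [heq]
      linarith [Real.add_one_le_exp (z ^ 2 / (2 * t))]
    calc z ^ 2 ≤ Real.pi * z ^ 2 := by nlinarith [Real.pi_gt_three, sq_nonneg z]
      _ = 2 * Real.pi * t * (z ^ 2 / (2 * t)) := by field_simp
      _ ≤ _ := by gcongr
  have hrpow : (2 * Real.pi * t) ^ (-(1 : ℝ) / 2) = (√(2 * Real.pi * t))⁻¹ := by
    rw [neg_div, Real.rpow_neg hpos.le, Real.sqrt_eq_rpow]
  have hsplit : Real.exp (z ^ 2 / (4 * t)) * Real.exp (-z ^ 2 / (2 * t))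
      = Real.exp (-z ^ 2 / (4 * t)) := by
    rw [← Real.exp_add]
    congr 1
    field_simp
    ring
  have hs : 0 < √(2 * Real.pi * t) := Real.sqrt_pos.mpr hpos
  unfold gaussKernel
  rw [hrpow, ← hsplit]
  calc |z| * ((√(2 * Real.pi * t))⁻¹ * Real.exp (-z ^ 2 / (2 * t)))
      ≤ (√(2 * Real.pi * t) * Real.exp (z ^ 2 / (4 * t))) *
          ((√(2 * Real.pi * t))⁻¹ * Real.exp (-z ^ 2 / (2 * t))) := by gcongr
    _ = _ := by field_simp

theorem abs_deriv_gaussKernel_le {t : ℝ} (ht : 0 < t) (z : ℝ) :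
    |-(z / t) * gaussKernel t z| ≤ t⁻¹ * Real.exp (-z ^ 2 / (4 * t)) := by
  have hnonneg : 0 ≤ gaussKernel t z := by unfold gaussKernel; positivity
  rw [abs_mul, abs_neg, abs_div, abs_of_pos ht, abs_of_nonneg hnonneg, div_eq_inv_mul, mul_assoc]
  gcongr
  exact abs_mul_gaussKernel_le ht z

theorem abs_sgn' (y : ℝ) : |sgn' y| = 1 := by
  unfold sgn'
  split_ifs <;> simp

theorem skewBMKernel_deriv_bound :
    ∃ C > (0 : ℝ), ∀ β ∈ Set.Ioo (-1 : ℝ) 1, ∀ t x y : ℝ, 0 < t → x ≠ 0 →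
      ∃ d : ℝ, HasDerivAt (fun x' => skewBMKernel β t x' y) d x ∧
        |d| ≤ C * t⁻¹ * Real.exp (-(x - y) ^ 2 / (4 * t)) := by
  refine ⟨2, two_pos, fun β hβ t x y ht hx => ?_⟩
  have hfree := (hasDerivAt_gaussKernel t (x - y)).comp x ((hasDerivAt_id x).sub_const y)
  have hrefl := (hasDerivAt_gaussKernel t (|x| + |y|)).comp x
    ((hasDerivAt_abs hx).add_const |y|)
  refine ⟨_, hfree.add (hrefl.const_mul (β * sgn' y)), ?_⟩
  have hcoeff : |β * sgn' y| ≤ 1 := by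
    rw [abs_mul, abs_sgn', mul_one]
    exact (abs_lt.mpr hβ).le
  have hsign : |(SignType.sign x : ℝ)| ≤ 1 := by
    rcases lt_or_gt_of_ne hx with h | h <;> simp [h]
  have hsq : (x - y) ^ 2 ≤ (|x| + |y|) ^ 2 := by
    rw [← sq_abs (x - y)]
    gcongr
    exact abs_sub x y
  have hbound : |-((|x| + |y|) / t) * gaussKernel t (|x| + |y|)|
      ≤ t⁻¹ * Real.exp (-(x - y) ^ 2 / (4 * t)) := by
    refine (abs_deriv_gaussKernel_le ht _).trans ?_
    gcongr
  set E := t⁻¹ * Real.exp (-(x - y) ^ 2 / (4 * t)) with hE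
  have hE0 : 0 ≤ E := by positivity
  calc _ ≤ E + 1 * (E * 1) := by
        refine (abs_add_le _ _).trans (add_le_add ?_ ?_)
        · rw [mul_one]
          exact abs_deriv_gaussKernel_le ht _
        · rw [abs_mul, abs_mul _ (SignType.sign x : ℝ)]
          exact mul_le_mul hcoeff (mul_le_mul hbound hsign (abs_nonneg _) hE0)
            (by positivity) zero_le_one
    _ = _ := by rw [hE]; ring
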